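/- arXiv:math/0607535 — 4 statements merged into one kernel-verified Lean document; each statement's English description precedes it below -/
import Mathlib

section
/- Let N ≥ 1, let z ∈ ℝ^N with 0 < |z| ≤ 1, and let γ ∈ (−1,1). Then Φ_z maps the open cone Ω_γ bijectively onto the open cone Ω_δ, where δ = (γ + |z|)/(1 + 2γ|z| + |z|²)^{1/2}. -/
open InnerProductSpace

/-- For `0 < t ≤ 1`, the function `c ↦ (c + t) / √(1 + 2ct + t²)` is strictly increasing where the
radicand is positive. -/
lemma add_div_sqrt_lt {t c d : ℝ} (ht0 : 0 < t) (ht1 : t ≤ 1)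
    (hc : 0 < 1 + 2 * c * t + t ^ 2) (hcd : c < d) :
    (c + t) / √(1 + 2 * c * t + t ^ 2) < (d + t) / √(1 + 2 * d * t + t ^ 2) := by
  have hlt : 1 + 2 * c * t + t ^ 2 < 1 + 2 * d * t + t ^ 2 := by nlinarith
  have hs := Real.sqrt_pos.2 hc
  have hss := Real.sqrt_lt_sqrt hc.le hlt
  have hs2 := Real.sq_sqrt hc.le
  have hs2' := Real.sq_sqrt (hc.trans hlt).le
  generalize √(1 + 2 * c * t + t ^ 2) = x at *
  generalize √(1 + 2 * d * t + t ^ 2) = y at *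
  have hy : 0 < y := hs.trans hss
  rw [div_lt_div_iff₀ hs hy]
  have h : 0 < (x * y + (1 - t ^ 2)) * (y - x) :=
    mul_pos (add_pos_of_pos_of_nonneg (mul_pos hs hy) (by nlinarith)) (sub_pos.2 hss)
  have h2 : 2 * t * ((d + t) * x - (c + t) * y) = (x * y + (1 - t ^ 2)) * (y - x) := by
    linear_combination y * hs2 - x * hs2'
  rw [← h2] at h
  exact sub_pos.1 (pos_of_mul_pos_right h (by positivity))

lemma add_div_sqrt_lt_iff {t c d : ℝ} (ht0 : 0 < t) (ht1 : t ≤ 1)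
    (hc : 0 < 1 + 2 * c * t + t ^ 2) (hd : 0 < 1 + 2 * d * t + t ^ 2) :
    (c + t) / √(1 + 2 * c * t + t ^ 2) < (d + t) / √(1 + 2 * d * t + t ^ 2) ↔ c < d := by
  refine ⟨fun h => ?_, add_div_sqrt_lt ht0 ht1 hc⟩
  by_contra! hdc
  rcases hdc.eq_or_lt with rfl | hdc
  · exact lt_irrefl _ h
  · exact lt_asymm h (add_div_sqrt_lt ht0 ht1 hd hdc)

section

variable {E : Type*} [NormedAddCommGroup E] [InnerProductSpace ℝ E]

lemma norm_sq_add_norm_smul {u z : E} (hu : u ≠ 0) (hz : z ≠ 0) :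
    ‖u + ‖u‖ • z‖ ^ 2 =
      ‖u‖ ^ 2 * (1 + 2 * ⟪‖u‖⁻¹ • u, ‖z‖⁻¹ • z⟫_ℝ * ‖z‖ + ‖z‖ ^ 2) := by
  have hu' := norm_ne_zero_iff.2 hu
  have hz' := norm_ne_zero_iff.2 hz
  rw [norm_add_sq_real, norm_smul, norm_norm]
  simp only [real_inner_smul_left, real_inner_smul_right]
  field_simp

lemma inner_normalize_add_norm_smul {u z : E} (hu : u ≠ 0) (hz : z ≠ 0) :
    ⟪‖u + ‖u‖ • z‖⁻¹ • (u + ‖u‖ • z), ‖z‖⁻¹ • z⟫_ℝ =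
      (⟪‖u‖⁻¹ • u, ‖z‖⁻¹ • z⟫_ℝ + ‖z‖) /
        √(1 + 2 * ⟪‖u‖⁻¹ • u, ‖z‖⁻¹ • z⟫_ℝ * ‖z‖ + ‖z‖ ^ 2) := by
  have hu' := norm_ne_zero_iff.2 hu
  have hz' := norm_ne_zero_iff.2 hz
  have hn : ‖u + ‖u‖ • z‖ =
      ‖u‖ * √(1 + 2 * ⟪‖u‖⁻¹ • u, ‖z‖⁻¹ • z⟫_ℝ * ‖z‖ + ‖z‖ ^ 2) := by
    rw [← Real.sqrt_sq (norm_nonneg (u + ‖u‖ • z)), norm_sq_add_norm_smul hu hz,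
      Real.sqrt_mul (sq_nonneg _), Real.sqrt_sq (norm_nonneg u)]
  rw [real_inner_smul_left, hn]
  generalize √(1 + 2 * ⟪‖u‖⁻¹ • u, ‖z‖⁻¹ • z⟫_ℝ * ‖z‖ + ‖z‖ ^ 2) = s
  simp only [real_inner_smul_left, real_inner_smul_right, inner_add_left,
    real_inner_self_eq_norm_sq, mul_inv, div_eq_mul_inv]
  field_simp

lemma add_norm_smul_left_injOn {z : E} (hz1 : ‖z‖ ≤ 1) :
    Set.InjOn (fun u : E => u + ‖u‖ • z) {u | u + ‖u‖ • z ≠ 0} := by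
  have key : ∀ u w : E, u + ‖u‖ • z = w →
      ‖w‖ ^ 2 = ‖u‖ ^ 2 * (1 - ‖z‖ ^ 2) + 2 * ‖u‖ * ⟪w, z⟫_ℝ := by
    rintro u w rfl
    rw [norm_add_sq_real, norm_smul, norm_norm]
    simp only [real_inner_smul_left, real_inner_smul_right, inner_add_left,
      real_inner_self_eq_norm_sq]
    ring
  intro u hu v _ huv
  dsimp only at huv
  have hnorm : ‖u‖ = ‖v‖ := by
    by_contra hne
    have h1 := key u _ rfl
    have h2 := key v _ huv.symm
    have ha : 0 < ‖u + ‖u‖ • z‖ ^ 2 := pow_pos (norm_pos_iff.2 hu) 2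
    have h3 : (‖u‖ + ‖v‖) * (1 - ‖z‖ ^ 2) + 2 * ⟪u + ‖u‖ • z, z⟫_ℝ = 0 := by
      apply mul_left_cancel₀ (sub_ne_zero.2 hne)
      linear_combination h2 - h1
    have h4 : ‖u + ‖u‖ • z‖ ^ 2 = -(‖u‖ * ‖v‖ * (1 - ‖z‖ ^ 2)) := by
      linear_combination h1 + ‖u‖ * h3
    have h5 : 0 ≤ ‖u‖ * ‖v‖ * (1 - ‖z‖ ^ 2) :=
      mul_nonneg (by positivity) (by nlinarith [norm_nonneg z])
    linarith
  rw [hnorm] at huv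
  exact add_right_cancel huv

lemma exists_add_norm_smul_eq {z w : E} (hz1 : ‖z‖ ≤ 1) (hw : w ≠ 0)
    (h : ‖z‖ < 1 ∨ 0 < ⟪w, z⟫_ℝ) : ∃ u : E, u ≠ 0 ∧ u + ‖u‖ • z = w := by
  have hw' := norm_pos_iff.2 hw
  have ht : 0 ≤ 1 - ‖z‖ ^ 2 := by nlinarith [norm_nonneg z]
  set b := ⟪w, z⟫_ℝ with hb
  have hrad : 0 ≤ b ^ 2 + ‖w‖ ^ 2 * (1 - ‖z‖ ^ 2) := by positivity
  have hD : 0 < b + √(b ^ 2 + ‖w‖ ^ 2 * (1 - ‖z‖ ^ 2)) := by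
    rcases h with h | h
    · have : 0 < 1 - ‖z‖ ^ 2 := by nlinarith [norm_nonneg z]
      have : |b| < √(b ^ 2 + ‖w‖ ^ 2 * (1 - ‖z‖ ^ 2)) := by
        rw [← Real.sqrt_sq_eq_abs]
        exact Real.sqrt_lt_sqrt (sq_nonneg b) (lt_add_of_pos_right _ (by positivity))
      linarith [neg_abs_le b]
    · positivity
  have hs2 := Real.sq_sqrt hrad
  generalize √(b ^ 2 + ‖w‖ ^ 2 * (1 - ‖z‖ ^ 2)) = s at hD hs2
  obtain ⟨r, hr⟩ : ∃ r, r = ‖w‖ ^ 2 / (b + s) := ⟨_, rfl⟩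
  have hr0 : 0 < r := hr ▸ by positivity
  have hreq : r ^ 2 * (1 - ‖z‖ ^ 2) + 2 * r * b = ‖w‖ ^ 2 := by
    rw [hr]
    field_simp
    linear_combination -hs2
  have hn : ‖w - r • z‖ = r := by
    rw [← sq_eq_sq₀ (norm_nonneg _) hr0.le, norm_sub_sq_real, norm_smul, Real.norm_of_nonneg hr0.le,
      real_inner_smul_right, ← hb]
    linear_combination -hreq
  exact ⟨w - r • z, norm_pos_iff.1 (hn.symm ▸ hr0), by rw [hn, sub_add_cancel]⟩

end

/-- For `z ∈ ℝ^N` with `0 < |z| ≤ 1` and `γ ∈ (−1,1)`, the map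
`Φ_z(u) = u + |u| z` maps the open cone `Ω_γ` bijectively onto the open cone `Ω_δ`
with `δ = (γ + |z|)/√(1 + 2γ|z| + |z|²)`. -/
theorem phi_z_bijOn_cone (N : ℕ) (hN : 1 ≤ N)
    (z : EuclideanSpace ℝ (Fin N)) (hz0 : 0 < ‖z‖) (hz1 : ‖z‖ ≤ 1)
    (γ : ℝ) (hγl : -1 < γ) (hγr : γ < 1) :
    Set.BijOn (fun u : EuclideanSpace ℝ (Fin N) => u + ‖u‖ • z)
      {u : EuclideanSpace ℝ (Fin N) | u ≠ 0 ∧ γ < ⟪‖u‖⁻¹ • u, ‖z‖⁻¹ • z⟫_ℝ}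
      {w : EuclideanSpace ℝ (Fin N) | w ≠ 0 ∧
        (γ + ‖z‖) / Real.sqrt (1 + 2 * γ * ‖z‖ + ‖z‖ ^ 2) < ⟪‖w‖⁻¹ • w, ‖z‖⁻¹ • z⟫_ℝ} := by
  have hz : z ≠ 0 := norm_pos_iff.1 hz0
  have hγ : 0 < 1 + 2 * γ * ‖z‖ + ‖z‖ ^ 2 := by nlinarith [sq_nonneg (γ + ‖z‖)]
  have hmaps : ∀ u : EuclideanSpace ℝ (Fin N), u ≠ 0 → γ < ⟪‖u‖⁻¹ • u, ‖z‖⁻¹ • z⟫_ℝ →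
      0 < 1 + 2 * ⟪‖u‖⁻¹ • u, ‖z‖⁻¹ • z⟫_ℝ * ‖z‖ + ‖z‖ ^ 2 ∧ u + ‖u‖ • z ≠ 0 := by
    intro u hu hc
    have hpos : 0 < 1 + 2 * ⟪‖u‖⁻¹ • u, ‖z‖⁻¹ • z⟫_ℝ * ‖z‖ + ‖z‖ ^ 2 := by
      nlinarith [mul_lt_mul_of_pos_right hc hz0]
    refine ⟨hpos, fun h => ?_⟩
    have hsq := norm_sq_add_norm_smul hu hz
    rw [h, norm_zero] at hsq
    have := mul_pos (pow_pos (norm_pos_iff.2 hu) 2) hpos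
    linarith
  refine ⟨?_, ?_, ?_⟩
  · rintro u ⟨hu, hc⟩
    obtain ⟨hpos, hne⟩ := hmaps u hu hc
    refine ⟨hne, ?_⟩
    rw [inner_normalize_add_norm_smul hu hz]
    exact add_div_sqrt_lt hz0 hz1 hγ hc
  · exact (add_norm_smul_left_injOn hz1).mono fun u ⟨hu, hc⟩ => (hmaps u hu hc).2
  · rintro w ⟨hw, hδ⟩
    have hb : ‖z‖ < 1 ∨ 0 < ⟪w, z⟫_ℝ := by
      refine hz1.lt_or_eq.imp_right fun h1 => ?_
      have hδ0 : 0 < (γ + ‖z‖) / √(1 + 2 * γ * ‖z‖ + ‖z‖ ^ 2) :=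
        div_pos (by linarith) (Real.sqrt_pos.2 hγ)
      have hpos := hδ0.trans hδ
      rw [real_inner_smul_left, real_inner_smul_right] at hpos
      exact pos_of_mul_pos_right (pos_of_mul_pos_right hpos (by positivity)) (by positivity)
    obtain ⟨u, hu, rfl⟩ := exists_add_norm_smul_eq hz1 hw hb
    refine ⟨u, ⟨hu, ?_⟩, rfl⟩
    rw [inner_normalize_add_norm_smul hu hz] at hδ
    have hsq := pow_pos (norm_pos_iff.2 hw) 2
    rw [norm_sq_add_norm_smul hu hz] at hsq
    exact (add_div_sqrt_lt_iff hz0 hz1 hγ (pos_of_mul_pos_right hsq (sq_nonneg _))).1 hδ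
end

section
/- Let N ≥ 1, let f : ℝ^N → [0,∞) be measurable, and let η > 0, r > 0, R > 0. Then, as an inequality in [0,∞], ∫∫_{|v−v_*| ≥ R} f(v) f(v_*) |v − v_*|³ dv dv_* ≤ 8 e^{−r (R/2)^η} (∫ (1+|v|³) e^{r|v|^η} f(v) dv) (∫ (1+|v|³) f(v) dv). -/
open MeasureTheory

/-- The cube of a distance is controlled by the product of the weights `1 + |·|³`. -/
theorem norm_sub_pow_three_le {E : Type*} [SeminormedAddCommGroup E] (v w : E) :
    ‖v - w‖ ^ 3 ≤ 4 * ((1 + ‖v‖ ^ 3) * (1 + ‖w‖ ^ 3)) := by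
  have hv := norm_nonneg v
  have hw := norm_nonneg w
  calc ‖v - w‖ ^ 3 ≤ (‖v‖ + ‖w‖) ^ 3 := by gcongr; exact norm_sub_le v w
    _ ≤ 4 * (‖v‖ ^ 3 + ‖w‖ ^ 3) := by
      nlinarith [mul_nonneg (add_nonneg hv hw) (sq_nonneg (‖v‖ - ‖w‖))]
    _ ≤ 4 * ((1 + ‖v‖ ^ 3) * (1 + ‖w‖ ^ 3)) := by
      nlinarith [mul_nonneg (pow_nonneg hv 3) (pow_nonneg hw 3)]

/-- Exponential Chebyshev bound for the indicator of `{R ≤ |v - w|}`. -/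
theorem one_le_exp_mul_add_exp {E : Type*} [SeminormedAddCommGroup E] {η r R : ℝ}
    (hη : 0 < η) (hr : 0 < r) (hR : 0 < R) {v w : E} (h : R ≤ ‖v - w‖) :
    1 ≤ Real.exp (-r * (R / 2) ^ η) * (Real.exp (r * ‖v‖ ^ η) + Real.exp (r * ‖w‖ ^ η)) := by
  have key : ∀ x : ℝ, R / 2 ≤ x →
      1 ≤ Real.exp (-r * (R / 2) ^ η) * Real.exp (r * x ^ η) := fun x hx => by
    rw [← Real.exp_add, Real.one_le_exp_iff]
    have hpow : (R / 2) ^ η ≤ x ^ η := by gcongr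
    nlinarith
  rw [mul_add]
  have hsum := h.trans (norm_sub_le v w)
  rcases le_total (R / 2) ‖v‖ with hv | hv
  · exact le_add_of_le_of_nonneg (key _ hv) (by positivity)
  · exact le_add_of_nonneg_of_le (by positivity) (key _ (by linarith))

/-- For `f ≥ 0` measurable on `ℝ^N` and `η, r, R > 0`, as an inequality
in `[0,∞]`,
`∫∫_{|v−v_*| ≥ R} f f_* |v − v_*|³ ≤ 8 e^{−r(R/2)^η} (∫ (1+|v|³) e^{r|v|^η} f) (∫ (1+|v|³) f)`. -/
theorem dissipation_tail_estimate (N : ℕ) (hN : 1 ≤ N)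
    (f : EuclideanSpace ℝ (Fin N) → ℝ)
    (hf_meas : Measurable f) (hf_nonneg : ∀ v, 0 ≤ f v)
    (η r R : ℝ) (hη : 0 < η) (hr : 0 < r) (hR : 0 < R) :
    (∫⁻ v, ∫⁻ w, ENNReal.ofReal (if R ≤ ‖v - w‖ then f v * f w * ‖v - w‖ ^ 3 else 0))
      ≤ ENNReal.ofReal (8 * Real.exp (-r * (R / 2) ^ η)) *
          (∫⁻ v, ENNReal.ofReal ((1 + ‖v‖ ^ 3) * Real.exp (r * ‖v‖ ^ η) * f v)) *
          (∫⁻ v, ENNReal.ofReal ((1 + ‖v‖ ^ 3) * f v)) := by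
  set E := Real.exp (-r * (R / 2) ^ η)
  set a : EuclideanSpace ℝ (Fin N) → ℝ :=
    fun v => (1 + ‖v‖ ^ 3) * Real.exp (r * ‖v‖ ^ η) * f v with ha
  set b : EuclideanSpace ℝ (Fin N) → ℝ := fun v => (1 + ‖v‖ ^ 3) * f v with hb
  have ha_nonneg : ∀ v, 0 ≤ a v := fun v => mul_nonneg (by positivity) (hf_nonneg v)
  have hb_nonneg : ∀ v, 0 ≤ b v := fun v => mul_nonneg (by positivity) (hf_nonneg v)
  have ha_meas : Measurable fun v => ENNReal.ofReal (a v) := by fun_prop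
  have hb_meas : Measurable fun v => ENNReal.ofReal (b v) := by fun_prop
  have hE_pos : 0 < E := Real.exp_pos _
  have pointwise : ∀ v w,
      (if R ≤ ‖v - w‖ then f v * f w * ‖v - w‖ ^ 3 else 0)
        ≤ 4 * E * (a v * b w + b v * a w) := fun v w => by
    have hav := ha_nonneg v
    have haw := ha_nonneg w
    have hbv := hb_nonneg v
    have hbw := hb_nonneg w
    split_ifs with h
    · have hff := mul_nonneg (hf_nonneg v) (hf_nonneg w)
      calc f v * f w * ‖v - w‖ ^ 3
          ≤ f v * f w * (4 * ((1 + ‖v‖ ^ 3) * (1 + ‖w‖ ^ 3))) := by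
            gcongr; exact norm_sub_pow_three_le v w
        _ ≤ f v * f w * (4 * ((1 + ‖v‖ ^ 3) * (1 + ‖w‖ ^ 3))) *
              (E * (Real.exp (r * ‖v‖ ^ η) + Real.exp (r * ‖w‖ ^ η))) :=
            le_mul_of_one_le_right (by positivity) (one_le_exp_mul_add_exp hη hr hR h)
        _ = 4 * E * (a v * b w + b v * a w) := by simp only [ha, hb]; ring
    · positivity
  calc _ ≤ ∫⁻ v, ∫⁻ w, ENNReal.ofReal (4 * E) *
          (ENNReal.ofReal (a v) * ENNReal.ofReal (b w) +
            ENNReal.ofReal (b v) * ENNReal.ofReal (a w)) := by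
        refine lintegral_mono fun v => lintegral_mono fun w => ?_
        rw [← ENNReal.ofReal_mul (ha_nonneg v), ← ENNReal.ofReal_mul (hb_nonneg v),
          ← ENNReal.ofReal_add (mul_nonneg (ha_nonneg v) (hb_nonneg w))
            (mul_nonneg (hb_nonneg v) (ha_nonneg w)),
          ← ENNReal.ofReal_mul (by positivity)]
        exact ENNReal.ofReal_le_ofReal (pointwise v w)
    _ = ENNReal.ofReal (4 * E) *
          ((∫⁻ v, ENNReal.ofReal (a v)) * (∫⁻ v, ENNReal.ofReal (b v)) +
            (∫⁻ v, ENNReal.ofReal (b v)) * ∫⁻ v, ENNReal.ofReal (a v)) := by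
        have inner : ∀ v, ∫⁻ w, ENNReal.ofReal (4 * E) *
            (ENNReal.ofReal (a v) * ENNReal.ofReal (b w) +
              ENNReal.ofReal (b v) * ENNReal.ofReal (a w)) =
            ENNReal.ofReal (4 * E) * (ENNReal.ofReal (a v) * (∫⁻ w, ENNReal.ofReal (b w)) +
              ENNReal.ofReal (b v) * ∫⁻ w, ENNReal.ofReal (a w)) := fun v => by
          rw [lintegral_const_mul _ (by fun_prop),
            lintegral_add_left (hb_meas.const_mul _), lintegral_const_mul _ hb_meas,
            lintegral_const_mul _ ha_meas]
        simp_rw [inner]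
        rw [lintegral_const_mul _ (by fun_prop),
          lintegral_add_left (ha_meas.mul_const _), lintegral_mul_const _ ha_meas,
          lintegral_mul_const _ hb_meas]
    _ = _ := by
        have h8 : ENNReal.ofReal (8 * E) = ENNReal.ofReal (4 * E) * 2 := by
          rw [← ENNReal.ofReal_ofNat 2, ← ENNReal.ofReal_mul (by positivity)]
          congr 1
          ring
        rw [h8]
        ring
end

section
/- Let N ≥ 1, z ∈ ℝ^N, v ∈ ℝ^N, and define ψ_{v,z} : ℝ^N → ℝ^N by ψ_{v,z}(v_*) = v + (1/2)(v_* − v + |v_* − v| z). Then for every v_* ≠ v, ψ_{v,z} is Fréchet differentiable at v_* with derivative the linear map h ↦ (1/2)(h + ⟨ŵ, h⟩ z), where ŵ = (v_* − v)/|v_* − v|, and the determinant of this linear map equals 2^{−N} (1 + ⟨ŵ, z⟩). -/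
open InnerProductSpace

theorem hasFDerivAt_norm_of_ne_zero {E : Type*} [NormedAddCommGroup E] [InnerProductSpace ℝ E]
    {x : E} (hx : x ≠ 0) :
    HasFDerivAt (fun y : E => ‖y‖) (innerSL ℝ (‖x‖⁻¹ • x)) x := by
  have hn : ‖x‖ ≠ 0 := norm_ne_zero_iff.mpr hx
  have h := (hasStrictFDerivAt_norm_sq x).hasFDerivAt.sqrt (pow_ne_zero 2 hn)
  simp only [Real.sqrt_sq (norm_nonneg _)] at h
  refine h.congr_fderiv ?_
  ext y
  simp
  field_simp

/-- The collision map `ψ_{v,z}(v_*) = v + (1/2)(v_* − v + |v_* − v| z)`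
is Fréchet differentiable at any `v_* ≠ v`, with derivative
`h ↦ (1/2)(h + ⟪ŵ, h⟫ z)` where `ŵ = (v_* − v)/|v_* − v|`, and the determinant of
this linear map equals `2^{−N} (1 + ⟪ŵ, z⟫)`. -/
theorem collision_map_hasFDerivAt_and_det (N : ℕ) (hN : 1 ≤ N)
    (z v : EuclideanSpace ℝ (Fin N)) (vs : EuclideanSpace ℝ (Fin N)) (hvs : vs ≠ v) :
    HasFDerivAt
      (fun w : EuclideanSpace ℝ (Fin N) => v + (2:ℝ)⁻¹ • (w - v + ‖w - v‖ • z))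
      ((2:ℝ)⁻¹ • (ContinuousLinearMap.id ℝ (EuclideanSpace ℝ (Fin N)) +
        (innerSL ℝ (‖vs - v‖⁻¹ • (vs - v))).smulRight z)) vs ∧
    LinearMap.det
      (((2:ℝ)⁻¹ • (ContinuousLinearMap.id ℝ (EuclideanSpace ℝ (Fin N)) +
        (innerSL ℝ (‖vs - v‖⁻¹ • (vs - v))).smulRight z) :
          EuclideanSpace ℝ (Fin N) →L[ℝ] EuclideanSpace ℝ (Fin N)) :
        EuclideanSpace ℝ (Fin N) →ₗ[ℝ] EuclideanSpace ℝ (Fin N))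
      = (2:ℝ) ^ (-(N:ℤ)) * (1 + ⟪‖vs - v‖⁻¹ • (vs - v), z⟫_ℝ) := by
  constructor
  · have hsub : HasFDerivAt (fun w : EuclideanSpace ℝ (Fin N) => w - v)
        (ContinuousLinearMap.id ℝ (EuclideanSpace ℝ (Fin N))) vs :=
      (hasFDerivAt_id vs).sub_const v
    have hnorm := (hasFDerivAt_norm_of_ne_zero (sub_ne_zero.mpr hvs)).comp vs hsub
    exact ((hsub.add (hnorm.smul_const z)).const_smul (2:ℝ)⁻¹).const_add v
  · have h := LinearMap.transvection.det
      (innerSL ℝ (‖vs - v‖⁻¹ • (vs - v))).toLinearMap z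
    rw [ContinuousLinearMap.toLinearMap_smul, LinearMap.det_smul, finrank_euclideanSpace_fin,
      zpow_neg, zpow_natCast, inv_pow]
    congr 1
end

section
/- Let N ≥ 1 and let Λ : [0,∞) → [0,∞) satisfy Λ(0) = 0 and be differentiable with derivative Λ' a continuous strictly increasing bijection from [0,∞) onto [0,∞). For a measurable g : ℝ^N → [0,∞) define the Luxemburg norm ‖g‖_{L^Λ} = inf{λ > 0 : ∫ Λ(g/λ) dv ≤ 1} and, for measurable h : ℝ^N → [0,∞), the gauge N^{Λ*}(h) = sup{∫ g h dv : g : ℝ^N → [0,∞) measurable, ∫ Λ(g) dv ≤ 1}. Let f : ℝ^N → [0,∞) be measurable with 0 < ‖f‖_{L^Λ} < ∞ and ∫ Λ(f/‖f‖_{L^Λ}) dv = 1. Then, as an equality in [0,∞], ∫ f Λ'(f/‖f‖_{L^Λ}) dv = ‖f‖_{L^Λ} · N^{Λ*}(Λ'(f/‖f‖_{L^Λ})). -/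
open MeasureTheory ENNReal

/-- The Luxemburg norm `‖f‖_{L^Λ} = inf{λ > 0 : ∫ Λ(f/λ) ≤ 1}` of a nonnegative
measurable function on `ℝ^N`. -/
noncomputable def luxemburgNorm {N : ℕ} (Λ : ℝ → ℝ)
    (f : EuclideanSpace ℝ (Fin N) → ℝ) : ℝ :=
  sInf {l : ℝ | 0 < l ∧ (∫⁻ v, ENNReal.ofReal (Λ (f v / l))) ≤ 1}

/-- The gauge `N^{Λ*}(h) = sup{∫ g h : g ≥ 0 measurable, ∫ Λ(g) ≤ 1}` (a value in
`[0,∞]`). -/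
noncomputable def orliczGauge {N : ℕ} (Λ : ℝ → ℝ)
    (h : EuclideanSpace ℝ (Fin N) → ℝ) : ℝ≥0∞ :=
  ⨆ (g : EuclideanSpace ℝ (Fin N) → ℝ) (_ : Measurable g) (_ : ∀ v, 0 ≤ g v)
    (_ : (∫⁻ v, ENNReal.ofReal (Λ (g v))) ≤ 1), ∫⁻ v, ENNReal.ofReal (g v * h v)

/-- A differentiable function whose derivative is monotone on `[0,∞)` lies above its tangents. -/
lemma add_mul_sub_le_of_hasDerivAt_monotoneOn {Λ D : ℝ → ℝ}
    (hderiv : ∀ x, 0 ≤ x → HasDerivAt Λ (D x) x) (hD : MonotoneOn D (Set.Ici 0))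
    {a b : ℝ} (ha : 0 ≤ a) (hb : 0 ≤ b) : Λ a + D a * (b - a) ≤ Λ b := by
  have hconv : ConvexOn ℝ (Set.Ici 0) Λ := by
    refine MonotoneOn.convexOn_of_deriv (convex_Ici 0)
      (fun x hx => (hderiv x hx).continuousAt.continuousWithinAt) ?_ ?_
    · rw [interior_Ici]
      exact fun x hx => (hderiv x (le_of_lt hx)).differentiableAt.differentiableWithinAt
    · rw [interior_Ici]
      intro x hx y hy hxy
      rw [(hderiv x (le_of_lt hx)).deriv, (hderiv y (le_of_lt hy)).deriv]
      exact hD (Set.Ioi_subset_Ici_self hx) (Set.Ioi_subset_Ici_self hy) hxy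
  rcases lt_trichotomy a b with h | rfl | h
  · have := hconv.le_slope_of_hasDerivAt ha hb h (hderiv a ha)
    rw [slope_def_field, le_div_iff₀ (sub_pos.2 h)] at this
    linarith
  · simp
  · have := hconv.slope_le_of_hasDerivAt hb ha h (hderiv a ha)
    rw [slope_def_field, div_le_iff₀ (sub_pos.2 h)] at this
    linarith

/-- Composing a function continuous on `[0,∞)` with a nonnegative measurable one gives a
measurable function. -/
lemma ContinuousOn.measurable_comp_of_nonneg {α : Type*} [MeasurableSpace α] {F : ℝ → ℝ}
    (hF : ContinuousOn F (Set.Ici 0)) {g : α → ℝ} (hg : Measurable g) (hg0 : ∀ v, 0 ≤ g v) :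
    Measurable fun v => F (g v) := by
  have hc : Continuous fun x => F (max x 0) :=
    hF.comp_continuous (continuous_id.max continuous_const) fun x => le_max_right x 0
  have hm := hc.measurable.comp hg
  simpa [Function.comp_def, max_eq_left (hg0 _)] using hm

/-- If `∫ Λ(u) = 1` then the gauge of `Λ'(u)` is attained at `u`. -/
lemma orliczGauge_deriv_eq {N : ℕ} {Λ D : ℝ → ℝ} (hΛ0 : Λ 0 = 0)
    (hderiv : ∀ x, 0 ≤ x → HasDerivAt Λ (D x) x) (hD_mono : MonotoneOn D (Set.Ici 0))
    (hD_nonneg : ∀ x, 0 ≤ x → 0 ≤ D x)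
    {u : EuclideanSpace ℝ (Fin N) → ℝ} (hu : Measurable u) (hu0 : ∀ v, 0 ≤ u v)
    (hnorm : (∫⁻ v, ENNReal.ofReal (Λ (u v))) = 1) :
    orliczGauge Λ (fun v => D (u v)) = ∫⁻ v, ENNReal.ofReal (u v * D (u v)) := by
  have hΛ_nonneg : ∀ x, 0 ≤ x → 0 ≤ Λ x := fun x hx => by
    have h := add_mul_sub_le_of_hasDerivAt_monotoneOn hderiv hD_mono le_rfl hx
    have := mul_nonneg (hD_nonneg 0 le_rfl) hx
    rw [hΛ0, sub_zero] at h
    linarith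
  have hΛ_cont : ContinuousOn Λ (Set.Ici 0) :=
    fun x hx => (hderiv x hx).continuousAt.continuousWithinAt
  refine le_antisymm ?_ ?_
  · refine iSup_le fun g => iSup_le fun hg => iSup_le fun hg0 => iSup_le fun hg1 => ?_
    refine (ENNReal.add_le_add_iff_right ENNReal.one_ne_top).1 ?_
    calc (∫⁻ v, ENNReal.ofReal (g v * D (u v))) + 1
        = (∫⁻ v, ENNReal.ofReal (g v * D (u v))) + ∫⁻ v, ENNReal.ofReal (Λ (u v)) := by
          rw [hnorm]
      _ ≤ ∫⁻ v, (ENNReal.ofReal (g v * D (u v)) + ENNReal.ofReal (Λ (u v))) :=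
          le_lintegral_add _ _
      _ ≤ ∫⁻ v, (ENNReal.ofReal (u v * D (u v)) + ENNReal.ofReal (Λ (g v))) := by
          refine lintegral_mono fun v => ?_
          rw [← ENNReal.ofReal_add (mul_nonneg (hg0 v) (hD_nonneg _ (hu0 v)))
              (hΛ_nonneg _ (hu0 v)),
            ← ENNReal.ofReal_add (mul_nonneg (hu0 v) (hD_nonneg _ (hu0 v)))
              (hΛ_nonneg _ (hg0 v))]
          refine ENNReal.ofReal_le_ofReal ?_
          linarith [add_mul_sub_le_of_hasDerivAt_monotoneOn hderiv hD_mono (hu0 v) (hg0 v)]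
      _ = (∫⁻ v, ENNReal.ofReal (u v * D (u v))) + ∫⁻ v, ENNReal.ofReal (Λ (g v)) :=
          lintegral_add_right _ (hΛ_cont.measurable_comp_of_nonneg hg hg0).ennreal_ofReal
      _ ≤ (∫⁻ v, ENNReal.ofReal (u v * D (u v))) + 1 := by gcongr
  · exact le_iSup_of_le u (le_iSup_of_le hu (le_iSup_of_le hu0 (le_iSup_of_le hnorm.le le_rfl)))

/-- equality case of Hölder's inequality in Orlicz spaces: for a Young
function `Λ` with derivative `D = Λ'` and `f ≥ 0` with `0 < ‖f‖_{L^Λ} < ∞` and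
`∫ Λ(f/‖f‖_{L^Λ}) = 1`, one has
`∫ f Λ'(f/‖f‖_{L^Λ}) = ‖f‖_{L^Λ} ⋅ N^{Λ*}(Λ'(f/‖f‖_{L^Λ}))` in `[0,∞]`. -/
theorem orlicz_holder_equality (N : ℕ) (hN : 1 ≤ N) (Λ D : ℝ → ℝ) (hΛ0 : Λ 0 = 0)
    (hderiv : ∀ x, 0 ≤ x → HasDerivAt Λ (D x) x)
    (hD_cont : ContinuousOn D (Set.Ici 0))
    (hD_mono : StrictMonoOn D (Set.Ici 0))
    (hD_bij : Set.BijOn D (Set.Ici 0) (Set.Ici 0))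
    (f : EuclideanSpace ℝ (Fin N) → ℝ)
    (hf_meas : Measurable f) (hf_nonneg : ∀ v, 0 ≤ f v)
    (hpos : 0 < luxemburgNorm Λ f)
    (hfin : {l : ℝ | 0 < l ∧ (∫⁻ v, ENNReal.ofReal (Λ (f v / l))) ≤ 1}.Nonempty)
    (hnorm : (∫⁻ v, ENNReal.ofReal (Λ (f v / luxemburgNorm Λ f))) = 1) :
    (∫⁻ v, ENNReal.ofReal (f v * D (f v / luxemburgNorm Λ f)))
      = ENNReal.ofReal (luxemburgNorm Λ f) *
          orliczGauge Λ (fun v => D (f v / luxemburgNorm Λ f)) := by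
  have hu0 : ∀ v, 0 ≤ f v / luxemburgNorm Λ f := fun v => div_nonneg (hf_nonneg v) hpos.le
  rw [orliczGauge_deriv_eq hΛ0 hderiv hD_mono.monotoneOn (fun x hx => hD_bij.mapsTo hx)
    (hf_meas.div_const _) hu0 hnorm, ← lintegral_const_mul' _ _ ENNReal.ofReal_ne_top]
  refine lintegral_congr fun v => ?_
  rw [← ENNReal.ofReal_mul hpos.le, ← mul_assoc, mul_div_cancel₀ _ hpos.ne']
end
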